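/- Let q be a prime power, let n ≥ 3 with (n, q) ∉ {(3,2), (4,2)}, and let S = PSL_n(q) be the projective special linear group of degree n over the field with q elements, identified with Inn(S) ≤ Aut(S). Then every group R with S ≤ R ≤ Aut(S) possesses a maximal subgroup with trivial normal core in R whose index in R equals (qⁿ − 1)/(q − 1) or equals (qⁿ − 1)(q^{n−1} − 1)/(q − 1)². -/

import Mathlib

section

open MulAction
open scoped Pointwise LinearAlgebra.Projectivization

section Abstract

variable {S : Type*} [Group S]

theorem smul_conj_smul (r : MulAut S) (s : S) (K : Subgroup S) :
    r • MulAut.conj s • K = MulAut.conj (r s) • r • K := by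
  rw [smul_smul, smul_smul]
  congr 1
  ext t
  simp

theorem index_mulAut_smul (r : MulAut S) (K : Subgroup S) : (r • K).index = K.index :=
  Subgroup.index_map_equiv K r

theorem isCoatom_stabilizer_and_normalCore_eq_bot_and_index_eq (T : Subgroup S)
    (R : Subgroup (MulAut S)) (hR : (MulAut.conj : S →* MulAut S).range ≤ R) (hT : T ≠ ⊤)
    (htrans : ∀ r ∈ R, ∃ s : S, r • T = MulAut.conj s • T)
    (hfaith : ∀ t : S, (∀ s : S, MulAut.conj t • MulAut.conj s • T = MulAut.conj s • T) → t = 1)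
    (hself : ∀ s : S, MulAut.conj s • T = T → s ∈ T)
    (hmax : ∀ K : Subgroup S, T < K → (∀ m ∈ R, m • T = T → m • K = K) → K = ⊤) :
    IsCoatom (stabilizer R T) ∧ (stabilizer R T).normalCore = ⊥ ∧
      (stabilizer R T).index = T.index := by
  have hconj (s : S) : MulAut.conj s ∈ R := hR ⟨s, rfl⟩
  have hmem (s : S) : MulAut.conj s • T = T ↔ s ∈ T :=
    ⟨hself s, fun hs => Subgroup.conj_smul_eq_self_of_mem hs⟩
  refine ⟨⟨fun htop => hT ?_, fun L hL => ?_⟩, ?_, ?_⟩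
  · have hall (s : S) : MulAut.conj s • T = T := by
      have : (⟨MulAut.conj s, hconj s⟩ : R) ∈ stabilizer R T := htop ▸ Subgroup.mem_top _
      exact this
    exact (Subgroup.eq_top_iff' T).2 fun s => (hmem s).1 (hall s)
  · let f : S →* R := (MulAut.conj : S →* MulAut S).codRestrict R hconj
    have hdecomp (r : R) : ∃ s : S, (f s)⁻¹ * r ∈ stabilizer R T := by
      obtain ⟨s, hs⟩ := htrans r r.2
      refine ⟨s, ?_⟩
      rw [mem_stabilizer_iff, mul_smul, inv_smul_eq_iff]
      exact hs
    have hK : L.comap f = ⊤ := by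
      refine hmax _ (lt_of_le_of_ne (fun s hs => hL.le ?_) fun heq => ?_) fun m hm hmT => ?_
      · exact (hmem s).2 hs
      · refine hL.not_ge fun l hl => ?_
        obtain ⟨s, hs⟩ := hdecomp l
        have hsL : s ∈ L.comap f := by
          have := L.mul_mem hl (L.inv_mem (hL.le hs))
          simpa using this
        have hsM : f s ∈ stabilizer R T := (hmem s).2 (heq ▸ hsL)
        simpa using mul_mem hsM hs
      · have key (m : MulAut S) (hm : m ∈ R) (hmT : m • T = T) :
            m • L.comap f ≤ L.comap f := by
          rintro _ ⟨s, hs, rfl⟩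
          have hmL : (⟨m, hm⟩ : R) ∈ L := hL.le hmT
          have h := L.mul_mem (L.mul_mem hmL hs) (L.inv_mem hmL)
          have heq : (⟨m, hm⟩ : R) * f s * (⟨m, hm⟩ : R)⁻¹ = f (m s) := by
            ext t
            simp [f]
          rw [heq] at h
          exact h
        refine le_antisymm (key m hm hmT) ?_
        have := key m⁻¹ (R.inv_mem hm) (inv_smul_eq_iff.2 hmT.symm)
        rwa [Subgroup.pointwise_smul_subset_iff, inv_inv] at this
    refine (Subgroup.eq_top_iff' L).2 fun r => ?_
    obtain ⟨s, hs⟩ := hdecomp r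
    have hsL : s ∈ L.comap f := hK ▸ Subgroup.mem_top s
    simpa using L.mul_mem hsL (hL.le hs)
  · refine (Subgroup.eq_bot_iff_forall _).2 fun r hr => ?_
    have hfix (s : S) : (r : MulAut S) • MulAut.conj s • T = MulAut.conj s • T := by
      have h := hr ⟨MulAut.conj s, hconj s⟩⁻¹
      have h' : (MulAut.conj s)⁻¹ • (r : MulAut S) • (MulAut.conj s) • T = T := by
        have h2 := mem_stabilizer_iff.1 h
        rw [inv_inv, mul_smul, mul_smul] at h2
        exact h2
      exact (inv_smul_eq_iff.1 h')
    have hrT : (r : MulAut S) • T = T := by simpa using hfix 1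
    have hs (s : S) : (r : MulAut S) s = s := by
      refine (inv_mul_eq_one.1 (hfaith (s⁻¹ * (r : MulAut S) s) fun t => ?_)).symm
      have h1 := hfix (s * t)
      rw [map_mul, mul_smul, smul_conj_smul, hfix t] at h1
      rw [map_mul, mul_smul, h1, ← mul_smul, ← map_mul, inv_mul_cancel, map_one, one_smul]
    ext s
    exact hs s
  · let _ : MulAction S (Subgroup S) := MulAction.compHom _ (MulAut.conj : S →* MulAut S)
    have h1 : stabilizer S T = T := by
      ext s
      exact hmem s
    have h2 : orbit R T = orbit S T := by
      ext K
      constructor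
      · rintro ⟨r, rfl⟩
        obtain ⟨s, hs⟩ := htrans r r.2
        exact ⟨s, hs.symm⟩
      · rintro ⟨s, rfl⟩
        exact ⟨⟨MulAut.conj s, hconj s⟩, rfl⟩
    rw [index_stabilizer, h2, ← index_stabilizer, h1]

theorem stabilizer_smul_eq_conj_smul {X : Type*} [MulAction S X] (s : S) (x : X) :
    stabilizer S (s • x) = MulAut.conj s • stabilizer S x :=
  stabilizer_smul_eq_stabilizer_map_conj s x

theorem exists_smul_stabilizer_eq {X Y : Type*} [MulAction S X] [IsPretransitive S X]
    [MulAction S Y] (r : MulAut S) {x : X} {y : Y}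
    (h : r • stabilizer S x = stabilizer S y) (x' : X) :
    ∃ y' : Y, r • stabilizer S x' = stabilizer S y' := by
  obtain ⟨s, rfl⟩ := exists_smul_eq S x x'
  exact ⟨r s • y, by
    rw [stabilizer_smul_eq_conj_smul, smul_conj_smul, h, stabilizer_smul_eq_conj_smul]⟩

theorem exists_isCoatom_normalCore_eq_bot {X Y : Type*} [MulAction S X] [MulAction S Y]
    [FaithfulSMul S X] [IsPreprimitive S X] [IsPretransitive S Y] [Nontrivial X]
    (I : X → Y → Prop) (hI : ∀ x, ∃ y, I x y)
    (hItrans : ∀ x y x' y', I x y → I x' y' → ∃ s : S, s • x = x' ∧ s • y = y')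
    (hXinj : ∀ x y x', I x y → stabilizer S x ⊓ stabilizer S y ≤ stabilizer S x' → x' = x)
    (hYinj : ∀ x y y', I x y → stabilizer S x ⊓ stabilizer S y ≤ stabilizer S y' → y' = y)
    (hdisj : ∀ (x : X) (y : Y), stabilizer S x ≠ stabilizer S y)
    (hmax : ∀ x y, I x y → ∀ K : Subgroup S, stabilizer S x ⊓ stabilizer S y ≤ K →
      ¬ K ≤ stabilizer S x → ¬ K ≤ stabilizer S y → K = ⊤)
    (N J : ℕ) (hX : Nat.card X = N) (hY : Nat.card Y = N)
    (hclass : ∀ K : Subgroup S, K.index = N →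
      (∃ x : X, K = stabilizer S x) ∨ ∃ y : Y, K = stabilizer S y)
    (hJ : ∀ x y, (stabilizer S x ⊓ stabilizer S y).index = J ↔ I x y)
    (R : Subgroup (MulAut S)) (hR : (MulAut.conj : S →* MulAut S).range ≤ R) :
    ∃ M : Subgroup R, IsCoatom M ∧ M.normalCore = ⊥ ∧ (M.index = N ∨ M.index = J) := by
  have hstabX (x x' : X) (h : stabilizer S x = stabilizer S x') : x = x' := by
    obtain ⟨y, hy⟩ := hI x'
    exact hXinj x' y x hy (inf_le_left.trans h.ge)
  have hfaithX (t : S) (h : ∀ x : X, t • x = x) : t = 1 :=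
    FaithfulSMul.eq_of_smul_eq_smul (α := X) fun x => by rw [h x, one_smul]
  have hXcl (r : MulAut S) (x : X) := hclass (r • stabilizer S x)
    (by rw [index_mulAut_smul, index_stabilizer_of_transitive, hX])
  have hYcl (r : MulAut S) (y : Y) := hclass (r • stabilizer S y)
    (by rw [index_mulAut_smul, index_stabilizer_of_transitive, hY])
  obtain ⟨x⟩ : Nonempty X := inferInstance
  obtain ⟨y, hxy⟩ := hI x
  by_cases hcase : ∀ r ∈ R, ∀ x : X, ∃ x' : X, r • stabilizer S x = stabilizer S x'
  · have hco := IsPreprimitive.isCoatom_stabilizer_of_isPreprimitive S x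
    refine ⟨stabilizer R (stabilizer S x), ?_⟩
    have := isCoatom_stabilizer_and_normalCore_eq_bot_and_index_eq (stabilizer S x) R hR hco.1
      (fun r hr => ?_) (fun t ht => hfaithX t fun z => ?_) (fun s hs => ?_)
      (fun K hK _ => hco.2 K hK)
    · rw [index_stabilizer_of_transitive S x, hX] at this
      exact ⟨this.1, this.2.1, Or.inl this.2.2⟩
    · obtain ⟨x', hx'⟩ := hcase r hr x
      obtain ⟨s, rfl⟩ := exists_smul_eq S x x'
      exact ⟨s, by rw [hx', stabilizer_smul_eq_conj_smul]⟩
    · obtain ⟨s, rfl⟩ := exists_smul_eq S x z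
      apply hstabX
      rw [stabilizer_smul_eq_conj_smul, stabilizer_smul_eq_conj_smul, ht]
    · rw [← stabilizer_smul_eq_conj_smul] at hs
      exact hstabX _ _ hs
  · push Not at hcase
    obtain ⟨r₀, hr₀, x₀, hx₀⟩ := hcase
    have hswap : ∃ y₀ : Y, r₀ • stabilizer S x₀ = stabilizer S y₀ :=
      (hXcl r₀ x₀).resolve_left fun ⟨x', h⟩ => hx₀ x' h
    have htype (r : MulAut S) : (∃ x' y', r • stabilizer S x = stabilizer S x' ∧
          r • stabilizer S y = stabilizer S y' ∧ I x' y') ∨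
        (∃ x' y', r • stabilizer S x = stabilizer S y' ∧
          r • stabilizer S y = stabilizer S x' ∧ I x' y') := by
      have hidx : (r • stabilizer S x ⊓ r • stabilizer S y).index = J := by
        rw [← Subgroup.smul_inf, index_mulAut_smul]
        exact (hJ x y).2 hxy
      rcases hXcl r x with ⟨x', hx'⟩ | ⟨y', hy'⟩
      · rcases hYcl r y with ⟨x'', hx''⟩ | ⟨y', hy'⟩
        · obtain ⟨z, hz⟩ := exists_smul_stabilizer_eq r⁻¹ (inv_smul_eq_iff.2 hx'.symm) x''
          rw [inv_smul_eq_iff, ← hx'', smul_left_cancel_iff] at hz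
          exact absurd hz.symm (hdisj z y)
        · exact Or.inl ⟨x', y', hx', hy', (hJ _ _).1 (hx' ▸ hy' ▸ hidx)⟩
      · rcases hYcl r y with ⟨x', hx'⟩ | ⟨y'', hy''⟩
        · exact Or.inr ⟨x', y', hy', hx', (hJ _ _).1 (by rw [inf_comm, ← hx', ← hy', hidx])⟩
        · obtain ⟨z, hz⟩ := exists_smul_stabilizer_eq r⁻¹ (inv_smul_eq_iff.2 hy'.symm) y''
          rw [inv_smul_eq_iff, ← hy'', smul_left_cancel_iff] at hz
          exact absurd hz.symm (hdisj z y)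
    have hconj (s : S) : MulAut.conj s • (stabilizer S x ⊓ stabilizer S y) =
        stabilizer S (s • x) ⊓ stabilizer S (s • y) := by
      rw [Subgroup.smul_inf, stabilizer_smul_eq_conj_smul, stabilizer_smul_eq_conj_smul]
    refine ⟨stabilizer R (stabilizer S x ⊓ stabilizer S y), ?_⟩
    have := isCoatom_stabilizer_and_normalCore_eq_bot_and_index_eq
      (stabilizer S x ⊓ stabilizer S y) R hR
      (fun h => (IsPreprimitive.isCoatom_stabilizer_of_isPreprimitive S x).1
        (top_le_iff.1 (h.ge.trans inf_le_left)))
      (fun r _ => ?_) (fun t ht => hfaithX t fun z => ?_) (fun s hs => ?_) (fun K hK hKR => ?_)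
    · rw [(hJ x y).2 hxy] at this
      exact ⟨this.1, this.2.1, Or.inr this.2.2⟩
    · rcases htype r with ⟨x', y', hx', hy', h⟩ | ⟨x', y', hx', hy', h⟩
      · obtain ⟨s, rfl, rfl⟩ := hItrans x y x' y' hxy h
        exact ⟨s, by rw [hconj, Subgroup.smul_inf, hx', hy']⟩
      · obtain ⟨s, rfl, rfl⟩ := hItrans x y x' y' hxy h
        exact ⟨s, by rw [hconj, Subgroup.smul_inf, hx', hy', inf_comm]⟩
    · obtain ⟨s, rfl⟩ := exists_smul_eq S x z
      have h := ht s
      rw [← mul_smul, ← map_mul, hconj, hconj, mul_smul, mul_smul] at h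
      have hI' : I (s • x) (s • y) := by
        rw [← hJ, ← hconj, index_mulAut_smul]
        exact (hJ x y).2 hxy
      exact hXinj _ _ _ hI' (h.ge.trans inf_le_left)
    · rw [hconj] at hs
      exact ⟨hXinj _ _ _ hxy (hs.ge.trans inf_le_left), hYinj _ _ _ hxy (hs.ge.trans inf_le_right)⟩
    · obtain ⟨y₀, hy₀⟩ := hswap
      obtain ⟨x', y', hx', hy', h⟩ := (htype r₀).resolve_left fun ⟨x', _, hx', _⟩ => by
        obtain ⟨z, hz⟩ := exists_smul_stabilizer_eq r₀ hx' x₀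
        exact hx₀ z hz
      obtain ⟨s, rfl, rfl⟩ := hItrans x y x' y' hxy h
      have hmR : (MulAut.conj s)⁻¹ * r₀ ∈ R := R.mul_mem (R.inv_mem (hR ⟨s, rfl⟩)) hr₀
      have hmx : ((MulAut.conj s)⁻¹ * r₀) • stabilizer S x = stabilizer S y := by
        rw [mul_smul, hx', stabilizer_smul_eq_conj_smul, inv_smul_smul]
      have hmy : ((MulAut.conj s)⁻¹ * r₀) • stabilizer S y = stabilizer S x := by
        rw [mul_smul, hy', stabilizer_smul_eq_conj_smul, inv_smul_smul]
      have hmK := hKR _ hmR (by rw [Subgroup.smul_inf, hmx, hmy, inf_comm])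
      refine hmax x y hxy K hK.le (fun hle => hK.not_ge ?_) (fun hle => hK.not_ge ?_)
      · refine le_inf hle ?_
        rw [← hmK, ← hmx]
        exact Subgroup.pointwise_smul_le_pointwise_smul_iff.2 hle
      · refine le_inf ?_ hle
        rw [← hmK, ← hmy]
        exact Subgroup.pointwise_smul_le_pointwise_smul_iff.2 hle

end Abstract

section Linear

open Matrix

variable {ι F : Type*} [Fintype ι] [DecidableEq ι] [Field F]

theorem exists_dotProduct_eq_zero_ne_zero {u x : ι → F} (h : ∀ c : F, c • u ≠ x) :
    ∃ f : ι → F, f ⬝ᵥ u = 0 ∧ f ⬝ᵥ x ≠ 0 := by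
  have hx : x ∉ Submodule.span F {u} := fun hx => by
    obtain ⟨c, hc⟩ := Submodule.mem_span_singleton.1 hx
    exact h c hc
  obtain ⟨g, hg, hle⟩ := Submodule.exists_le_ker_of_notMem hx
  obtain ⟨f, rfl⟩ := (dotProductEquiv F ι).surjective g
  refine ⟨f, ?_, hg⟩
  exact hle (Submodule.mem_span_singleton_self u)

theorem exists_dotProduct_eq_zero_ne_zero_ne_zero {u x y : ι → F} (hx : ∀ c : F, c • u ≠ x)
    (hy : ∀ c : F, c • u ≠ y) : ∃ f : ι → F, f ⬝ᵥ u = 0 ∧ f ⬝ᵥ x ≠ 0 ∧ f ⬝ᵥ y ≠ 0 := by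
  obtain ⟨f, hfu, hfx⟩ := exists_dotProduct_eq_zero_ne_zero hx
  obtain ⟨g, hgu, hgy⟩ := exists_dotProduct_eq_zero_ne_zero hy
  by_cases hfy : f ⬝ᵥ y = 0
  · by_cases hgx : g ⬝ᵥ x = 0
    · exact ⟨f + g, by simp [add_dotProduct, hfu, hgu], by simpa [add_dotProduct, hgx],
        by simpa [add_dotProduct, hfy]⟩
    · exact ⟨g, hgu, hgx, hgy⟩
  · exact ⟨f, hfu, hfx, hfy⟩

namespace Matrix.SpecialLinearGroup

/-- The transvection `x ↦ x + (f ⬝ᵥ x) • v`. -/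
def vecTransvection (v f : ι → F) (h : f ⬝ᵥ v = 0) : SpecialLinearGroup ι F :=
  ⟨1 + vecMulVec v f, by
    rw [vecMulVec_eq Unit, det_one_add_replicateCol_mul_replicateRow, h, add_zero]⟩

theorem vecTransvection_smul (v f : ι → F) (h : f ⬝ᵥ v = 0) (x : ι → F) :
    vecTransvection v f h • x = x + (f ⬝ᵥ x) • v := by
  change (1 + vecMulVec v f) *ᵥ x = _
  rw [add_mulVec, one_mulVec, vecMulVec_mulVec]
  simp

theorem ext_smul {g h : SpecialLinearGroup ι F} (H : ∀ x : ι → F, g • x = h • x) : g = h :=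
  Subtype.ext (ext_iff_smul.2 H)

theorem conj_vecTransvection (k : SpecialLinearGroup ι F) (v f : ι → F) (h : f ⬝ᵥ v = 0)
    (w f' : ι → F) (h' : f' ⬝ᵥ w = 0) (hw : k • v = w) (hf : ∀ x, f' ⬝ᵥ (k • x) = f ⬝ᵥ x) :
    k * vecTransvection v f h * k⁻¹ = vecTransvection w f' h' := by
  apply ext_smul
  intro x
  rw [mul_smul, mul_smul, vecTransvection_smul, vecTransvection_smul, smul_add, smul_inv_smul,
    smul_comm k, hw, ← hf, smul_inv_smul]

theorem vecTransvection_inv (v f : ι → F) (h : f ⬝ᵥ v = 0) :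
    (vecTransvection v f h)⁻¹ = vecTransvection (-v) f (by simpa using h) := by
  rw [inv_eq_iff_mul_eq_one]
  apply ext_smul
  intro x
  rw [mul_smul, vecTransvection_smul, vecTransvection_smul]
  simp [dotProduct_add, h]

theorem smul_dotProduct_eq (g : SpecialLinearGroup ι F) (x y : ι → F) :
    (g • x) ⬝ᵥ y = x ⬝ᵥ (g.transpose • y) := by
  change (g.1 *ᵥ x) ⬝ᵥ y = x ⬝ᵥ (g.1ᵀ *ᵥ y)
  rw [dotProduct_mulVec, vecMul_transpose]

theorem transpose_mul (g h : SpecialLinearGroup ι F) :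
    (g * h).transpose = h.transpose * g.transpose :=
  Subtype.ext (Matrix.transpose_mul g.1 h.1)

theorem transpose_inv (g : SpecialLinearGroup ι F) : (g⁻¹).transpose = (g.transpose)⁻¹ := by
  rw [eq_inv_iff_mul_eq_one, ← transpose_mul, mul_inv_cancel]
  exact Subtype.ext transpose_one

theorem transpose_transpose (g : SpecialLinearGroup ι F) : g.transpose.transpose = g :=
  Subtype.ext (Matrix.transpose_transpose g.1)

/-- The inverse transpose automorphism. -/
@[simps]
def contragredient : SpecialLinearGroup ι F ≃* SpecialLinearGroup ι F where
  toFun g := (g⁻¹).transpose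
  invFun g := (g⁻¹).transpose
  left_inv g := by
    change ((g⁻¹).transpose)⁻¹.transpose = g
    rw [transpose_inv, transpose_transpose, inv_inv]
  right_inv g := by
    change ((g⁻¹).transpose)⁻¹.transpose = g
    rw [transpose_inv, transpose_transpose, inv_inv]
  map_mul' g h := by rw [_root_.mul_inv_rev, transpose_mul]

theorem smul_dotProduct_contragredient_smul (g : SpecialLinearGroup ι F) (x y : ι → F) :
    (g • x) ⬝ᵥ (contragredient g • y) = x ⬝ᵥ y := by
  rw [smul_dotProduct_eq, contragredient_apply, transpose_inv, smul_inv_smul]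

theorem contragredient_vecTransvection_smul (v f : ι → F) (h : f ⬝ᵥ v = 0) (y : ι → F) :
    contragredient (vecTransvection v f h) • y = y - (v ⬝ᵥ y) • f := by
  rw [contragredient_apply, vecTransvection_inv]
  change (1 + vecMulVec (-v) f)ᵀ *ᵥ y = _
  rw [transpose_add, transpose_vecMulVec, transpose_one, add_mulVec, one_mulVec, vecMulVec_mulVec]
  simp [sub_eq_add_neg]

theorem transvection_eq_vecTransvection {i j : ι} (hij : i ≠ j) (b : F) :
    transvection hij b = vecTransvection (Pi.single i 1) (Pi.single j b) (by simp [hij]) := by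
  refine Subtype.ext ?_
  change Matrix.transvection i j b = 1 + vecMulVec _ _
  ext k l
  simp only [Matrix.transvection, Matrix.add_apply, vecMulVec_apply, Matrix.single_apply,
    Pi.single_apply]
  grind

theorem diag2n_eq {i j : ι} (hij : i ≠ j) {a : F} (ha : a ≠ 0) :
    diag2n hij a ha = transvection hij a * transvection hij.symm (-a⁻¹) * transvection hij a *
      (transvection hij (-1) * transvection hij.symm 1 * transvection hij (-1)) := by
  apply ext_smul
  intro x
  simp only [mul_smul, transvection_eq_vecTransvection, vecTransvection_smul]
  ext k
  simp [diag2n_coe, mulVec_diagonal, dotProduct_add, Pi.single_apply,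
    Matrix.SpecialLinearGroup.smul_def]
  have hji := hij.symm
  by_cases hki : k = i
  · subst hki
    simp [hij, hji]
    field_simp
    ring
  · by_cases hkj : k = j
    · subst hkj
      simp [hij, hji]
      field_simp
      ring
    · simp [hki, hkj]

theorem eq_top_of_vecTransvection_mem [Nontrivial ι] (K : Subgroup (SpecialLinearGroup ι F))
    (hK : ∀ v f h, vecTransvection v f h ∈ K) : K = ⊤ := by
  have ht {i j : ι} (hij : i ≠ j) (b : F) : transvection hij b ∈ K :=
    transvection_eq_vecTransvection hij b ▸ hK _ _ _
  refine (Subgroup.eq_top_iff' K).2 fun g => ?_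
  induction g using diagonal_transvection_induction' with
  | hdiag i j hij hc =>
    rw [diag2n_eq hij hc]
    exact K.mul_mem (K.mul_mem (K.mul_mem (ht _ _) (ht _ _)) (ht _ _))
      (K.mul_mem (K.mul_mem (ht _ _) (ht _ _)) (ht _ _))
  | htransvec i j hij a => exact ht hij a
  | hmul A B hA hB => exact K.mul_mem hA hB

theorem vecTransvection_smul_mem {K : Subgroup (SpecialLinearGroup ι F)} {v : ι → F}
    (hK : ∀ f h, vecTransvection v f h ∈ K) {k : SpecialLinearGroup ι F} (hk : k ∈ K) (c : F)
    (f : ι → F) (h : f ⬝ᵥ (c • k • v) = 0) : vecTransvection (c • k • v) f h ∈ K := by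
  have h₁ : (c • f) ⬝ᵥ (k • v) = 0 := by rwa [smul_dotProduct, ← dotProduct_smul]
  have h₂ : (k.transpose • c • f) ⬝ᵥ v = 0 := by
    rw [dotProduct_comm, ← smul_dotProduct_eq, dotProduct_comm, h₁]
  have h₃ : vecTransvection (c • k • v) f h = vecTransvection (k • v) (c • f) h₁ := by
    apply ext_smul
    intro x
    rw [vecTransvection_smul, vecTransvection_smul, smul_dotProduct, smul_smul, smul_eq_mul,
      mul_comm]
  rw [h₃, ← conj_vecTransvection k v (k.transpose • c • f) h₂ (k • v) (c • f) h₁ rfl fun x => by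
    rw [dotProduct_comm, smul_dotProduct_eq, dotProduct_comm]]
  exact K.mul_mem (K.mul_mem hk (hK _ _)) (K.inv_mem hk)

/-- If a subgroup `K` contains all transvections with centre `v`, then the multiples of the
vectors in the `K`-orbit of `v` form a subspace. -/
def orbitSubmodule (K : Subgroup (SpecialLinearGroup ι F)) (v : ι → F)
    (hK : ∀ f h, vecTransvection v f h ∈ K) : Submodule F (ι → F) where
  carrier := {x | ∃ c : F, ∃ k ∈ K, c • k • v = x}
  zero_mem' := ⟨0, 1, K.one_mem, zero_smul _ _⟩
  smul_mem' a x := by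
    rintro ⟨c, k, hk, rfl⟩
    exact ⟨a * c, k, hk, mul_smul _ _ _⟩
  add_mem' {x y} := by
    rintro ⟨c, k, hk, rfl⟩ ⟨d, l, hl, rfl⟩
    by_cases h : ∃ a : F, a • c • k • v = d • l • v
    · obtain ⟨a, ha⟩ := h
      exact ⟨(1 + a) * c, k, hk, by rw [← ha, mul_smul, add_smul, one_smul]⟩
    · push Not at h
      obtain ⟨f, hf, hf'⟩ := exists_dotProduct_eq_zero_ne_zero h
      have h₀ : ((f ⬝ᵥ (d • l • v))⁻¹ • f) ⬝ᵥ (c • k • v) = 0 := by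
        rw [smul_dotProduct, hf, smul_zero]
      refine ⟨d, vecTransvection (c • k • v) _ h₀ * l,
        K.mul_mem (vecTransvection_smul_mem hK hk c _ _) hl, ?_⟩
      rw [mul_smul, ← smul_comm, vecTransvection_smul, smul_dotProduct, smul_eq_mul,
        inv_mul_cancel₀ hf', one_smul, add_comm]

section orbitSubmodule

variable {K : Subgroup (SpecialLinearGroup ι F)} {v : ι → F}
  {hK : ∀ f h, vecTransvection v f h ∈ K}

theorem self_mem_orbitSubmodule : v ∈ orbitSubmodule K v hK :=
  ⟨1, 1, K.one_mem, by rw [one_smul, one_smul]⟩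

theorem smul_mem_orbitSubmodule {k : SpecialLinearGroup ι F} (hk : k ∈ K) {x : ι → F}
    (hx : x ∈ orbitSubmodule K v hK) : k • x ∈ orbitSubmodule K v hK := by
  obtain ⟨c, l, hl, rfl⟩ := hx
  exact ⟨c, k * l, K.mul_mem hk hl, by rw [mul_smul, smul_comm k c]⟩

theorem eq_top_of_orbitSubmodule_eq_top [Nontrivial ι] (h : orbitSubmodule K v hK = ⊤) :
    K = ⊤ := by
  refine eq_top_of_vecTransvection_mem K fun x f hf => ?_
  obtain ⟨c, k, hk, rfl⟩ : x ∈ orbitSubmodule K v hK := h ▸ Submodule.mem_top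
  exact vecTransvection_smul_mem hK hk c f hf

end orbitSubmodule

theorem exists_smul_eq_contragredient_smul {k : SpecialLinearGroup ι F} {w : ι → F}
    (h : ∀ z, w ⬝ᵥ z = 0 → w ⬝ᵥ (k⁻¹ • z) = 0) : ∃ c : F, c • w = contragredient k • w := by
  by_contra! hkw
  obtain ⟨z, hzw, hz⟩ := exists_dotProduct_eq_zero_ne_zero hkw
  refine hz ?_
  rw [← smul_inv_smul k z, smul_dotProduct_contragredient_smul, dotProduct_comm]
  exact h z (by rwa [dotProduct_comm])

theorem eq_top_of_flag_stabilizer_le [Nontrivial ι] {v w : ι → F} (hvw : w ⬝ᵥ v = 0)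
    (K : Subgroup (SpecialLinearGroup ι F))
    (hK : ∀ g : SpecialLinearGroup ι F, (∃ c : F, c • v = g • v) →
      (∃ c : F, c • w = contragredient g • w) → g ∈ K)
    (hv : ∃ k ∈ K, ∀ c : F, c • v ≠ k • v)
    (hw : ∃ k ∈ K, ∀ c : F, c • w ≠ contragredient k • w) : K = ⊤ := by
  have hT (a f : ι → F) (h : f ⬝ᵥ a = 0) (hfv : f ⬝ᵥ v = 0) (haw : a ⬝ᵥ w = 0) :
      vecTransvection a f h ∈ K :=
    hK _ ⟨1, by simp [vecTransvection_smul, hfv]⟩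
      ⟨1, by simp only [contragredient_vecTransvection_smul, haw]; simp⟩
  have hQ (f : ι → F) (h : f ⬝ᵥ v = 0) : vecTransvection v f h ∈ K :=
    hT v f h h (by rwa [dotProduct_comm])
  have hmove (f u z : ι → F) (hfv : f ⬝ᵥ v = 0) (hfu : f ⬝ᵥ u ≠ 0) (hfz : f ⬝ᵥ z ≠ 0)
      (hw : w ⬝ᵥ ((f ⬝ᵥ z)⁻¹ • z - (f ⬝ᵥ u)⁻¹ • u) = 0) (hu : u ∈ orbitSubmodule K v hQ) :
      z ∈ orbitSubmodule K v hQ := by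
    have h : f ⬝ᵥ ((f ⬝ᵥ z)⁻¹ • z - (f ⬝ᵥ u)⁻¹ • u) = 0 := by
      simp [dotProduct_sub, hfu, hfz]
    have := smul_mem_orbitSubmodule (hT _ f h hfv (by rwa [dotProduct_comm]))
      (Submodule.smul_mem _ (f ⬝ᵥ u)⁻¹ hu)
    rw [vecTransvection_smul, dotProduct_smul, smul_eq_mul, inv_mul_cancel₀ hfu, one_smul,
      add_sub_cancel] at this
    exact (Submodule.smul_mem_iff _ (inv_ne_zero hfz)).1 this
  by_cases hcase : ∃ u ∈ orbitSubmodule K v hQ, w ⬝ᵥ u ≠ 0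
  · obtain ⟨u, hu, hwu⟩ := hcase
    have key (z : ι → F) (hz : w ⬝ᵥ z ≠ 0) : z ∈ orbitSubmodule K v hQ :=
      hmove w u z hvw hwu hz (by simp [dotProduct_sub, hwu, hz]) hu
    refine eq_top_of_orbitSubmodule_eq_top (hK := hQ) (Submodule.eq_top_iff'.2 fun z => ?_)
    by_cases hz : w ⬝ᵥ z = 0
    · refine (Submodule.add_mem_iff_left _ hu).1 (key (z + u) ?_)
      rwa [dotProduct_add, hz, zero_add]
    · exact key z hz
  · push Not at hcase
    obtain ⟨k₀, hk₀, hk₀v⟩ := hv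
    have hW (z : ι → F) (hz : w ⬝ᵥ z = 0) : z ∈ orbitSubmodule K v hQ := by
      by_cases hzv : ∃ c : F, c • v = z
      · obtain ⟨c, rfl⟩ := hzv
        exact Submodule.smul_mem _ _ self_mem_orbitSubmodule
      · push Not at hzv
        obtain ⟨f, hfv, hf₀, hfz⟩ := exists_dotProduct_eq_zero_ne_zero_ne_zero hk₀v hzv
        have h₀ := smul_mem_orbitSubmodule hk₀ (self_mem_orbitSubmodule (hK := hQ))
        exact hmove f _ z hfv hf₀ hfz (by simp [dotProduct_sub, hz, hcase _ h₀]) h₀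
    obtain ⟨k, hk, hkw⟩ := hw
    obtain ⟨c, hc⟩ := exists_smul_eq_contragredient_smul (k := k) (w := w) fun z hz =>
      hcase _ (smul_mem_orbitSubmodule (K.inv_mem hk) (hW z hz))
    exact absurd hc (hkw c)

theorem exists_smul_eq_and_contragredient_smul {c v w w' : ι → F} (hcw : c ⬝ᵥ w ≠ 0)
    (hcw' : c ⬝ᵥ w' ≠ 0) (h : (c ⬝ᵥ w)⁻¹ * (w ⬝ᵥ v) = (c ⬝ᵥ w')⁻¹ * (w' ⬝ᵥ v)) :
    ∃ g : SpecialLinearGroup ι F, g • v = v ∧ ∃ a : F, a • w' = contragredient g • w := by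
  have hf : ((c ⬝ᵥ w)⁻¹ • w - (c ⬝ᵥ w')⁻¹ • w') ⬝ᵥ c = 0 := by
    rw [sub_dotProduct, smul_dotProduct, smul_dotProduct, dotProduct_comm w, dotProduct_comm w',
      smul_eq_mul, smul_eq_mul, inv_mul_cancel₀ hcw, inv_mul_cancel₀ hcw', sub_self]
  refine ⟨vecTransvection c _ hf, ?_, (c ⬝ᵥ w) * (c ⬝ᵥ w')⁻¹, ?_⟩
  · rw [vecTransvection_smul, sub_dotProduct, smul_dotProduct, smul_dotProduct, smul_eq_mul,
      smul_eq_mul, h, sub_self, zero_smul, add_zero]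
  · rw [contragredient_vecTransvection_smul, smul_sub, smul_smul, smul_smul, mul_inv_cancel₀ hcw,
      one_smul, sub_sub_cancel]

end Matrix.SpecialLinearGroup

end Linear

section DualPoint

open Matrix

variable {ι F : Type*} [Field F]

theorem exists_ne_zero_dotProduct_eq_zero_dotProduct_eq_zero [Fintype ι]
    (hι : 2 < Fintype.card ι) (u v : ι → F) : ∃ f : ι → F, f ≠ 0 ∧ f ⬝ᵥ u = 0 ∧ f ⬝ᵥ v = 0 := by
  have h : LinearMap.ker ((dotProductBilin F F).flip u |>.prod
      ((dotProductBilin F F).flip v)) ≠ ⊥ := by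
    apply LinearMap.ker_ne_bot_of_finrank_lt
    simpa using hι
  obtain ⟨f, hf, hf₀⟩ := Submodule.exists_mem_ne_zero_of_ne_bot h
  rw [LinearMap.mem_ker, LinearMap.prod_apply] at hf
  exact ⟨f, hf₀, congrArg Prod.fst hf, congrArg Prod.snd hf⟩

theorem exists_smul_eq_of_smul_eq_add_smul {u u' : ι → F} {c d : F} (hu : u ≠ 0) (hd : d ≠ 0)
    (h : c • u' = u' + d • u) : ∃ a : F, a • u = u' := by
  have h₁ : d • u = (c - 1) • u' := by rw [sub_smul, h, one_smul, add_sub_cancel_left]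
  have h₂ : c - 1 ≠ 0 := fun h₂ => by
    rw [h₂, zero_smul] at h₁
    exact (smul_ne_zero hd hu) h₁
  exact ⟨(c - 1)⁻¹ * d, by rw [mul_smul, h₁, inv_smul_smul₀ h₂]⟩

variable (ι F) in
/-- The points of the dual of the projective space `ℙ F (ι → F)`, where a linear form is
represented by the vector that defines it through the dot product. -/
def DualPoint := ℙ F (ι → F)

namespace DualPoint

/-- The dual point defined by a nonzero vector. -/
def mk (w : ι → F) (hw : w ≠ 0) : DualPoint ι F := Projectivization.mk F w hw

theorem ind {P : DualPoint ι F → Prop} (h : ∀ w hw, P (mk w hw)) (y : DualPoint ι F) : P y :=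
  Projectivization.ind h y

theorem mk_eq_mk_iff {w w' : ι → F} (hw : w ≠ 0) (hw' : w' ≠ 0) :
    mk w hw = mk w' hw' ↔ ∃ a : F, a • w' = w :=
  Projectivization.mk_eq_mk_iff' F w w' hw hw'

instance [Finite ι] [Finite F] : Finite (DualPoint ι F) := inferInstanceAs (Finite (ℙ F (ι → F)))

theorem natCard : Nat.card (DualPoint ι F) = Nat.card (ℙ F (ι → F)) := rfl

variable [Fintype ι]

/-- Incidence of points and dual points. -/
def Incident (x : ℙ F (ι → F)) (y : DualPoint ι F) : Prop :=
  Projectivization.rep (V := ι → F) y ⬝ᵥ x.rep = 0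

theorem incident_mk {v w : ι → F} (hv : v ≠ 0) (hw : w ≠ 0) :
    Incident (Projectivization.mk F v hv) (mk w hw) ↔ w ⬝ᵥ v = 0 := by
  obtain ⟨a, ha⟩ := Projectivization.exists_smul_eq_mk_rep F v hv
  obtain ⟨b, hb⟩ := Projectivization.exists_smul_eq_mk_rep F w hw
  unfold Incident mk
  rw [← ha, ← hb]
  simp [Units.smul_def]

theorem exists_incident (hι : 2 < Fintype.card ι) (x : ℙ F (ι → F)) :
    ∃ y : DualPoint ι F, Incident x y := by
  induction x using Projectivization.ind with | _ v hv
  obtain ⟨w, hw, hwv, -⟩ := exists_ne_zero_dotProduct_eq_zero_dotProduct_eq_zero hι v v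
  exact ⟨mk w hw, (incident_mk hv hw).2 hwv⟩

variable [DecidableEq ι]

open Matrix.SpecialLinearGroup

instance : MulAction (SpecialLinearGroup ι F) (DualPoint ι F) :=
  MulAction.compHom (ℙ F (ι → F)) (contragredient (ι := ι) (F := F)).toMonoidHom

theorem smul_mk (g : SpecialLinearGroup ι F) {w : ι → F} (hw : w ≠ 0) :
    g • mk w hw = mk (contragredient g • w) ((smul_ne_zero_iff_ne _).mpr hw) := rfl

instance : IsPretransitive (SpecialLinearGroup ι F) (DualPoint ι F) where
  exists_smul_eq y y' := by
    obtain ⟨g, hg⟩ := exists_smul_eq (SpecialLinearGroup ι F) (α := ℙ F (ι → F)) y y'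
    refine ⟨contragredient.symm g, ?_⟩
    exact (congrArg (fun k : SpecialLinearGroup ι F => HSMul.hSMul (β := ℙ F (ι → F)) k y)
      (MulEquiv.apply_symm_apply contragredient g)).trans hg

/-- The action of the special linear group on the dual points factors through the projective
special linear group. -/
def toPermHom : ProjectiveSpecialLinearGroup ι F →* Equiv.Perm (DualPoint ι F) :=
  QuotientGroup.lift _ (MulAction.toPermHom _ _) fun g hg => by
    have h : contragredient g ∈ Subgroup.center (SpecialLinearGroup ι F) :=
      MulEquivClass.apply_mem_center contragredient hg
    rw [← Projectivization.SL_mulAction_ker] at h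
    exact Equiv.ext fun y => DFunLike.congr_fun (MonoidHom.mem_ker.1 h) y

instance : MulAction (ProjectiveSpecialLinearGroup ι F) (DualPoint ι F) :=
  MulAction.compHom _ toPermHom

theorem projectiveSpecialLinearGroup_smul (g : SpecialLinearGroup ι F) (y : DualPoint ι F) :
    (g : ProjectiveSpecialLinearGroup ι F) • y = g • y := rfl

theorem incident_smul_smul (g : SpecialLinearGroup ι F) (x : ℙ F (ι → F)) (y : DualPoint ι F) :
    Incident (g • x) (g • y) ↔ Incident x y := by
  induction x using Projectivization.ind with | _ v hv
  induction y using DualPoint.ind with | _ w hw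
  rw [Projectivization.smul_mk, smul_mk, incident_mk, incident_mk, dotProduct_comm,
    smul_dotProduct_contragredient_smul, dotProduct_comm]

theorem mem_stabilizer_mk {g : SpecialLinearGroup ι F} {w : ι → F} (hw : w ≠ 0) :
    g ∈ stabilizer (SpecialLinearGroup ι F) (mk w hw) ↔ ∃ c : F, c • w = contragredient g • w := by
  rw [mem_stabilizer_iff, smul_mk, mk_eq_mk_iff]

theorem _root_.Projectivization.mem_stabilizer_mk {g : SpecialLinearGroup ι F} {v : ι → F}
    (hv : v ≠ 0) : g ∈ stabilizer (SpecialLinearGroup ι F) (Projectivization.mk F v hv) ↔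
      ∃ c : F, c • v = g • v := by
  rw [mem_stabilizer_iff, Projectivization.smul_mk, Projectivization.mk_eq_mk_iff']

theorem exists_smul_eq_and_smul_eq {x x' : ℙ F (ι → F)} {y y' : DualPoint ι F}
    (h : Incident x y ↔ Incident x' y') :
    ∃ g : SpecialLinearGroup ι F, g • x = x' ∧ g • y = y' := by
  obtain ⟨g, rfl⟩ := exists_smul_eq (SpecialLinearGroup ι F) x x'
  rw [← incident_smul_smul g x y] at h
  suffices h' : ∃ k : SpecialLinearGroup ι F, k • g • x = g • x ∧ k • g • y = y' by
    obtain ⟨k, hk, hk'⟩ := h'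
    exact ⟨k * g, by rw [mul_smul, hk], by rw [mul_smul, hk']⟩
  generalize g • x = x at h
  generalize g • y = y at h
  induction x using Projectivization.ind with | _ v hv
  induction y using DualPoint.ind with | _ w hw
  induction y' using DualPoint.ind with | _ w' hw'
  rw [incident_mk, incident_mk] at h
  suffices h' : ∃ c : ι → F, c ⬝ᵥ w ≠ 0 ∧ c ⬝ᵥ w' ≠ 0 ∧
      (c ⬝ᵥ w)⁻¹ * (w ⬝ᵥ v) = (c ⬝ᵥ w')⁻¹ * (w' ⬝ᵥ v) by
    obtain ⟨c, hcw, hcw', hc⟩ := h'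
    obtain ⟨k, hk, a, ha⟩ := exists_smul_eq_and_contragredient_smul hcw hcw' hc
    refine ⟨k, ?_, ?_⟩
    · rw [Projectivization.smul_mk, Projectivization.mk_eq_mk_iff']
      exact ⟨1, by rw [one_smul, hk]⟩
    · rw [smul_mk, mk_eq_mk_iff]
      exact ⟨a, ha⟩
  by_cases hwv : w ⬝ᵥ v = 0
  · obtain ⟨c, -, hcw, hcw'⟩ :=
        exists_dotProduct_eq_zero_ne_zero_ne_zero (u := 0) (x := w) (y := w')
          (by simpa using hw.symm) (by simpa using hw'.symm)
    exact ⟨c, hcw, hcw', by rw [hwv, h.1 hwv, mul_zero, mul_zero]⟩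
  · have hwv' := fun h' => hwv (h.2 h')
    rw [dotProduct_comm] at hwv hwv'
    exact ⟨v, hwv, hwv', by
      rw [dotProduct_comm w, dotProduct_comm w', inv_mul_cancel₀ hwv, inv_mul_cancel₀ hwv']⟩

theorem eq_of_stabilizer_inf_le_stabilizer {x x' : ℙ F (ι → F)} {y : DualPoint ι F}
    (hxy : Incident x y) (h : stabilizer (SpecialLinearGroup ι F) x ⊓
      stabilizer (SpecialLinearGroup ι F) y ≤ stabilizer (SpecialLinearGroup ι F) x') :
    x' = x := by
  induction x using Projectivization.ind with | _ v hv
  induction y using DualPoint.ind with | _ w hw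
  induction x' using Projectivization.ind with | _ v' hv'
  rw [incident_mk, dotProduct_comm] at hxy
  rw [Projectivization.mk_eq_mk_iff']
  by_contra! hne
  obtain ⟨f, hf, hf'⟩ := exists_dotProduct_eq_zero_ne_zero hne
  obtain ⟨c, hc⟩ := (Projectivization.mem_stabilizer_mk hv').1 <|
    @h (vecTransvection v f hf) ⟨(Projectivization.mem_stabilizer_mk hv).2
      ⟨1, by simp [vecTransvection_smul, hf]⟩, (mem_stabilizer_mk hw).2
      ⟨1, by rw [contragredient_vecTransvection_smul, hxy, zero_smul, one_smul, sub_zero]⟩⟩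
  rw [vecTransvection_smul] at hc
  obtain ⟨a, ha⟩ := exists_smul_eq_of_smul_eq_add_smul hv hf' hc
  exact hne a ha

theorem eq_of_stabilizer_inf_le_stabilizer' {x : ℙ F (ι → F)} {y y' : DualPoint ι F}
    (hxy : Incident x y) (h : stabilizer (SpecialLinearGroup ι F) x ⊓
      stabilizer (SpecialLinearGroup ι F) y ≤ stabilizer (SpecialLinearGroup ι F) y') :
    y' = y := by
  induction x using Projectivization.ind with | _ v hv
  induction y using DualPoint.ind with | _ w hw
  induction y' using DualPoint.ind with | _ w' hw'
  rw [incident_mk] at hxy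
  rw [mk_eq_mk_iff]
  by_contra! hne
  obtain ⟨a, ha, ha'⟩ := exists_dotProduct_eq_zero_ne_zero hne
  obtain ⟨c, hc⟩ := (mem_stabilizer_mk hw').1 <|
    @h (vecTransvection a w (by rwa [dotProduct_comm])) ⟨(Projectivization.mem_stabilizer_mk hv).2
      ⟨1, by simp [vecTransvection_smul, hxy]⟩, (mem_stabilizer_mk hw).2
      ⟨1, by rw [contragredient_vecTransvection_smul, ha, zero_smul, one_smul, sub_zero]⟩⟩
  rw [contragredient_vecTransvection_smul, sub_eq_add_neg, ← neg_smul] at hc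
  obtain ⟨b, hb⟩ := exists_smul_eq_of_smul_eq_add_smul hw (neg_ne_zero.2 ha') hc
  exact hne b hb

theorem stabilizer_ne_stabilizer (hι : 2 < Fintype.card ι) (x : ℙ F (ι → F))
    (y : DualPoint ι F) : stabilizer (SpecialLinearGroup ι F) x ≠
      stabilizer (SpecialLinearGroup ι F) y := by
  intro h
  induction x using Projectivization.ind with | _ v hv
  induction y using DualPoint.ind with | _ w hw
  obtain ⟨a, -, ha⟩ := exists_dotProduct_eq_zero_ne_zero (u := 0) (x := w) (by simpa using hw.symm)
  obtain ⟨f, hf, hfa, hfv⟩ := exists_ne_zero_dotProduct_eq_zero_dotProduct_eq_zero hι a v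
  obtain ⟨c, hc⟩ := (mem_stabilizer_mk hw).1 <| h ▸
    (Projectivization.mem_stabilizer_mk hv (g := vecTransvection a f hfa)).2
      ⟨1, by simp [vecTransvection_smul, hfv]⟩
  rw [contragredient_vecTransvection_smul, sub_eq_add_neg, ← neg_smul] at hc
  obtain ⟨b, rfl⟩ := exists_smul_eq_of_smul_eq_add_smul hf (neg_ne_zero.2 ha) hc
  rw [dotProduct_smul, dotProduct_comm, hfa, smul_zero] at ha
  exact ha rfl

theorem eq_top_of_stabilizer_inf_le [Nontrivial ι] {x : ℙ F (ι → F)} {y : DualPoint ι F}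
    (hxy : Incident x y) (K : Subgroup (SpecialLinearGroup ι F))
    (hK : stabilizer (SpecialLinearGroup ι F) x ⊓ stabilizer (SpecialLinearGroup ι F) y ≤ K)
    (hx : ¬ K ≤ stabilizer (SpecialLinearGroup ι F) x)
    (hy : ¬ K ≤ stabilizer (SpecialLinearGroup ι F) y) : K = ⊤ := by
  induction x using Projectivization.ind with | _ v hv
  induction y using DualPoint.ind with | _ w hw
  rw [incident_mk] at hxy
  obtain ⟨k, hk, hkv⟩ := SetLike.not_le_iff_exists.1 hx
  obtain ⟨l, hl, hlw⟩ := SetLike.not_le_iff_exists.1 hy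
  rw [Projectivization.mem_stabilizer_mk, not_exists] at hkv
  rw [mem_stabilizer_mk, not_exists] at hlw
  exact eq_top_of_flag_stabilizer_le hxy K
    (fun g hg hg' =>
      hK ⟨(Projectivization.mem_stabilizer_mk hv).2 hg, (mem_stabilizer_mk hw).2 hg'⟩)
    ⟨k, hk, hkv⟩ ⟨l, hl, hlw⟩

end DualPoint

end DualPoint

section Index

open Matrix

variable {ι F : Type*} [Fintype ι] [Field F]

theorem Matrix.det_one_add_eq_one_of_mul_self_eq_zero [Finite F] [DecidableEq ι]
    {A : Matrix ι ι F} (hA : A * A = 0) : (1 + A).det = 1 := by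
  obtain ⟨p, hp⟩ := CharP.exists F
  have : Fact p.Prime := ⟨CharP.char_is_prime F p⟩
  rcases isEmpty_or_nonempty ι with hι | hι
  · exact det_isEmpty
  have h : (1 + A) ^ p = 1 := by
    rw [add_pow_char_of_commute p (Commute.one_left A), one_pow,
      pow_eq_zero_of_le (Fact.out : p.Prime).two_le (by rw [pow_two, hA]), add_zero]
  apply frobenius_inj F p
  rw [frobenius_def, ← det_pow, h, det_one, map_one]

theorem Module.finrank_add_one_of_forall_mem_iff_dotProduct_eq_zero {W : Submodule F (ι → F)}
    {w : ι → F} (hw : w ≠ 0) (h : ∀ z, z ∈ W ↔ w ⬝ᵥ z = 0) :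
    Module.finrank F W + 1 = Fintype.card ι := by
  classical
  have h₁ : W = LinearMap.ker (dotProductEquiv F ι w) := Submodule.ext h
  rw [h₁, Module.Dual.finrank_ker_add_one_of_ne_zero, Module.finrank_fintype_fun_eq_card]
  simpa using hw

theorem DualPoint.index_stabilizer_inf [DecidableEq ι] (x : ℙ F (ι → F)) (y : DualPoint ι F) :
    (stabilizer (SpecialLinearGroup ι F) x ⊓ stabilizer (SpecialLinearGroup ι F) y).index =
      {p : ℙ F (ι → F) × DualPoint ι F |
        DualPoint.Incident p.1 p.2 ↔ DualPoint.Incident x y}.ncard := by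
  have h : stabilizer (SpecialLinearGroup ι F) x ⊓ stabilizer (SpecialLinearGroup ι F) y =
      stabilizer (SpecialLinearGroup ι F) (x, y) := by
    ext g
    simp [Prod.ext_iff]
  rw [h, index_stabilizer]
  congr 1
  ext ⟨x', y'⟩
  constructor
  · rintro ⟨g, hg⟩
    obtain ⟨rfl, rfl⟩ := Prod.ext_iff.1 hg
    exact DualPoint.incident_smul_smul g x y
  · intro h
    obtain ⟨g, rfl, rfl⟩ := DualPoint.exists_smul_eq_and_smul_eq (Iff.symm h)
    exact ⟨g, rfl⟩

variable [Fintype F]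

theorem Projectivization.natCard_mul (V : Type*) [AddCommGroup V] [Module F V] [Module.Finite F V] :
    Nat.card (ℙ F V) * (Fintype.card F - 1) = Fintype.card F ^ Module.finrank F V - 1 := by
  rw [← Nat.card_eq_fintype_card, ← Projectivization.card, Module.natCard_eq_pow_finrank (K := F)]

namespace DualPoint

theorem natCard_incident_mul (x : ℙ F (ι → F)) :
    Nat.card {y : DualPoint ι F // Incident x y} * (Fintype.card F - 1) =
      Fintype.card F ^ (Fintype.card ι - 1) - 1 := by
  classical
  induction x using Projectivization.ind with | _ v hv
  let W : Submodule F (ι → F) := LinearMap.ker (dotProductEquiv F ι v)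
  have hW : Module.finrank F W + 1 = Fintype.card ι :=
    Module.finrank_add_one_of_forall_mem_iff_dotProduct_eq_zero hv fun _ => Iff.rfl
  have e : Nat.card {y : DualPoint ι F // Incident (Projectivization.mk F v hv) y} =
      Nat.card (ℙ F W) := by
    symm
    have hinj := Projectivization.map_injective W.subtype W.subtype_injective
    rw [← Nat.card_range_of_injective hinj]
    refine Nat.card_congr (Equiv.subtypeEquivRight fun y => ?_)
    induction y using Projectivization.ind with | _ w hw
    refine Iff.trans ?_ (incident_mk hv hw).symm
    constructor
    · rintro ⟨y, hy⟩
      induction y using Projectivization.ind with | _ u hu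
      obtain ⟨a, rfl⟩ := (Projectivization.mk_eq_mk_iff' _ _ _ _ _).1 hy.symm
      have h : v ⬝ᵥ (u : ι → F) = 0 := u.2
      rw [smul_dotProduct, W.subtype_apply, dotProduct_comm, h, smul_zero]
    · intro h
      exact ⟨Projectivization.mk F ⟨w, (dotProduct_comm v w).trans h⟩
        (fun h => hw (congrArg Subtype.val h)), rfl⟩
  rw [e, Projectivization.natCard_mul, ← hW, Nat.add_sub_cancel]

theorem natCard_incident_prod_mul :
    Nat.card {p : ℙ F (ι → F) × DualPoint ι F // Incident p.1 p.2} * (Fintype.card F - 1) ^ 2 =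
      (Fintype.card F ^ Fintype.card ι - 1) * (Fintype.card F ^ (Fintype.card ι - 1) - 1) := by
  have := Fintype.ofFinite (ℙ F (ι → F))
  rw [Nat.card_congr (Equiv.subtypeProdEquivSigmaSubtype Incident), Nat.card_sigma, pow_two,
    ← mul_assoc, Finset.sum_mul, Finset.sum_congr rfl fun x _ => natCard_incident_mul x,
    Finset.sum_const, Finset.card_univ, ← Nat.card_eq_fintype_card, smul_eq_mul, mul_right_comm,
    Projectivization.natCard_mul, Module.finrank_fintype_fun_eq_card]

variable [DecidableEq ι]

open Matrix.SpecialLinearGroup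

theorem index_stabilizer_inf_eq_iff (hι : 2 < Fintype.card ι) (x : ℙ F (ι → F))
    (y : DualPoint ι F) :
    (stabilizer (SpecialLinearGroup ι F) x ⊓ stabilizer (SpecialLinearGroup ι F) y).index =
      Nat.card {p : ℙ F (ι → F) × DualPoint ι F // Incident p.1 p.2} ↔ Incident x y := by
  rw [index_stabilizer_inf]
  refine ⟨fun h => ?_, fun h => by simp only [h, iff_true]; rfl⟩
  by_contra hxy
  simp only [hxy, iff_false] at h
  set J := Nat.card {p : ℙ F (ι → F) × DualPoint ι F // Incident p.1 p.2} with hJ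
  have h₁ := Set.ncard_add_ncard_compl {p : ℙ F (ι → F) × DualPoint ι F | Incident p.1 p.2}
  have h₂ : {p : ℙ F (ι → F) × DualPoint ι F | Incident p.1 p.2}ᶜ.ncard = J := h
  have h₃ : {p : ℙ F (ι → F) × DualPoint ι F | Incident p.1 p.2}.ncard = J := rfl
  rw [h₂, h₃, Nat.card_prod, natCard] at h₁
  have h₄ := natCard_incident_prod_mul (ι := ι) (F := F)
  have h₅ := Projectivization.natCard_mul (F := F) (ι → F)
  rw [Module.finrank_fintype_fun_eq_card] at h₅
  rw [← hJ] at h₄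
  obtain ⟨m, hm⟩ : ∃ m, Fintype.card ι = m + 1 := ⟨_, (Nat.succ_pred_eq_of_pos (by omega)).symm⟩
  rw [hm] at h₄ h₅
  have hq := Fintype.one_lt_card (α := F)
  rw [Nat.add_sub_cancel, ← h₅] at h₄
  generalize Nat.card (ℙ F (ι → F)) = N at *
  have hpos := Nat.one_lt_pow (n := m) (by omega) hq
  rw [pow_succ] at h₅
  generalize Fintype.card F ^ m = M at *
  generalize Fintype.card F = q at *
  obtain ⟨q, rfl⟩ : ∃ r, q = r + 1 := ⟨q - 1, by omega⟩
  obtain ⟨M, rfl⟩ : ∃ r, M = r + 1 := ⟨M - 1, by omega⟩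
  simp only [Nat.add_sub_cancel] at *
  have h₆ : N * q = (M + 1) * (q + 1) - 1 := h₅
  have h₇ : 0 < N * q := by
    rw [h₆]
    have : 2 * 2 ≤ (M + 1) * (q + 1) := Nat.mul_le_mul (by omega) (by omega)
    omega
  have h₈ : N * q * (2 * M) = N * q * (N * q) := by
    calc N * q * (2 * M) = 2 * (J * q ^ 2) := by rw [h₄]; ring
      _ = (J + J) * q ^ 2 := by ring
      _ = N * q * (N * q) := by rw [h₁]; ring
  have h₉ := Nat.eq_of_mul_eq_mul_left h₇ h₈
  have : (M + 1) * 2 ≤ (M + 1) * (q + 1) := Nat.mul_le_mul le_rfl (by omega)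
  omega

end DualPoint

namespace Matrix.SpecialLinearGroup

variable [DecidableEq ι]

theorem card_pow_le_index {K : Subgroup (SpecialLinearGroup ι F)} {W : Submodule F (ι → F)}
    (hK : ∀ k ∈ K, ∀ x ∈ W, k • x ∈ W) :
    Fintype.card F ^ (Module.finrank F W * (Fintype.card ι - Module.finrank F W)) ≤ K.index := by
  obtain ⟨W', hW⟩ := Submodule.exists_isCompl W
  have hd := Submodule.finrank_add_eq_of_isCompl hW
  rw [Module.finrank_fintype_fun_eq_card] at hd
  let N (A : W →ₗ[F] W') : Matrix ι ι F :=
    LinearMap.toMatrix' (W'.subtype ∘ₗ A ∘ₗ W.projectionOnto W' hW)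
  have hN (A : W →ₗ[F] W') : N A * N A = 0 := by
    rw [← LinearMap.toMatrix'_comp, LinearEquiv.map_eq_zero_iff]
    exact LinearMap.ext fun x => by simp
  let T (A : W →ₗ[F] W') : SpecialLinearGroup ι F :=
    ⟨1 + N A, det_one_add_eq_one_of_mul_self_eq_zero (hN A)⟩
  have hT (A : W →ₗ[F] W') (x : W) : T A • (x : ι → F) = x + A x := by
    change (1 + N A) *ᵥ _ = _
    rw [add_mulVec, one_mulVec, LinearMap.toMatrix'_mulVec]
    simp
  have hinj : Function.Injective fun A => (T A : SpecialLinearGroup ι F ⧸ K) := fun A B hAB => by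
    ext1 x
    have h := hK _ (QuotientGroup.eq.1 hAB) x x.2
    generalize hy : ((T A)⁻¹ * T B) • (x : ι → F) = y at h
    rw [mul_smul, inv_smul_eq_iff, hT, hT A ⟨y, h⟩] at hy
    have hxy : x = ⟨y, h⟩ := by
      have hxy : x = W.projectionOnto W' hW y := by
        simpa using congrArg (W.projectionOnto W' hW) hy
      exact hxy.trans (Submodule.projectionOnto_apply_left hW ⟨y, h⟩)
    rw [← hxy, add_right_inj] at hy
    exact Subtype.ext hy.symm
  have := Nat.card_le_card_of_injective _ hinj
  rw [Module.natCard_eq_pow_finrank (K := F), Module.finrank_linearMap, Nat.card_eq_fintype_card,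
    ← Subgroup.index_eq_card] at this
  rwa [← hd, Nat.add_sub_cancel_left]

theorem exists_vecTransvection_mem (hι : 2 < Fintype.card ι)
    {K : Subgroup (SpecialLinearGroup ι F)} (hK : K.index = Nat.card (ℙ F (ι → F))) :
    ∃ v : ι → F, v ≠ 0 ∧ ∀ f h, vecTransvection v f h ∈ K := by
  obtain ⟨p, hp⟩ := CharP.exists F
  obtain ⟨m, hp', hm⟩ := FiniteField.card F p
  have : Fact p.Prime := ⟨hp'⟩
  obtain ⟨i⟩ : Nonempty ι := Fintype.card_pos_iff.1 (by omega)
  have hv : (Pi.single i 1 : ι → F) ≠ 0 := by simp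
  set v : ι → F := Pi.single i 1
  let A : Submodule F (ι → F) := LinearMap.ker (dotProductEquiv F ι v)
  have hA (f : ι → F) (hf : f ∈ A) : f ⬝ᵥ v = 0 := (dotProduct_comm f v).trans hf
  let φ : Multiplicative A →* SpecialLinearGroup ι F :=
    { toFun := fun f => vecTransvection v f.toAdd (hA _ f.toAdd.2)
      map_one' := ext_smul fun x => by simp [vecTransvection_smul]
      map_mul' := fun f g => ext_smul fun x => by
        rw [mul_smul, vecTransvection_smul, vecTransvection_smul, vecTransvection_smul]
        change x + (((f.toAdd : ι → F) + (g.toAdd : ι → F)) ⬝ᵥ x) • v = _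
        rw [dotProduct_add, dotProduct_smul, hA _ f.toAdd.2, smul_zero, add_zero, add_dotProduct,
          add_smul, add_assoc, add_comm (((f.toAdd : ι → F) ⬝ᵥ x) • v)] }
  let _ : MulAction (Multiplicative A) (SpecialLinearGroup ι F ⧸ K) := MulAction.compHom _ φ
  have hpA : IsPGroup p (Multiplicative A) := IsPGroup.of_card (n := m * Module.finrank F A) <| by
    rw [pow_mul, ← hm, ← Nat.card_eq_fintype_card, ← Module.natCard_eq_pow_finrank]
    rfl
  have hpK : ¬ p ∣ Nat.card (SpecialLinearGroup ι F ⧸ K) := fun hdvd => by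
    rw [← Subgroup.index_eq_card, hK] at hdvd
    have h₁ := hdvd.mul_right (Fintype.card F - 1)
    rw [Projectivization.natCard_mul, Module.finrank_fintype_fun_eq_card] at h₁
    have h₂ : p ∣ Fintype.card F ^ Fintype.card ι :=
      dvd_pow (hm ▸ dvd_pow_self p m.pos.ne') (by omega)
    have h₃ := (Nat.dvd_sub_iff_right (Nat.one_le_pow _ _ Fintype.card_pos) h₂).1 h₁
    exact hp'.one_lt.ne' (Nat.dvd_one.1 h₃)
  obtain ⟨g, hg⟩ := hpA.nonempty_fixed_point_of_prime_not_dvd_card _ hpK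
  induction g using QuotientGroup.induction_on with | _ g
  refine ⟨g⁻¹ • v, (smul_ne_zero_iff_ne _).2 hv, fun f hf => ?_⟩
  have hf' : (contragredient g • f) ⬝ᵥ v = 0 := by
    rw [dotProduct_comm, ← smul_inv_smul g v, smul_dotProduct_contragredient_smul,
      dotProduct_comm, hf]
  have h := hg (Multiplicative.ofAdd ⟨contragredient g • f, (dotProduct_comm v _).trans hf'⟩)
  have h' := QuotientGroup.eq.1 h.symm
  rw [← conj_vecTransvection g⁻¹ v _ hf' _ f hf rfl fun x => ?_, inv_inv, mul_assoc]
  · exact h'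
  · rw [dotProduct_comm, ← smul_dotProduct_contragredient_smul g, smul_inv_smul, dotProduct_comm]

theorem eq_stabilizer_of_index_eq (hι : 2 < Fintype.card ι)
    {K : Subgroup (SpecialLinearGroup ι F)} (hK : K.index = Nat.card (ℙ F (ι → F))) :
    (∃ x : ℙ F (ι → F), K = stabilizer (SpecialLinearGroup ι F) x) ∨
      ∃ y : DualPoint ι F, K = stabilizer (SpecialLinearGroup ι F) y := by
  have : Nontrivial ι := Fintype.one_lt_card_iff_nontrivial.1 (by omega)
  have heq {H : Subgroup (SpecialLinearGroup ι F)} (hH : H.index = Nat.card (ℙ F (ι → F)))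
      (h : K ≤ H) : K = H :=
    eq_of_le_of_not_lt h fun hlt => (Subgroup.index_strictAnti hlt).ne (hH.trans hK.symm)
  have hcard := Projectivization.natCard_mul (F := F) (ι → F)
  rw [Module.finrank_fintype_fun_eq_card] at hcard
  have hq := Fintype.one_lt_card (α := F)
  obtain ⟨v, hv, hvK⟩ := exists_vecTransvection_mem hι hK
  set W := orbitSubmodule K v hvK with hW
  have hvW : v ∈ W := self_mem_orbitSubmodule
  have hKW : ∀ k ∈ K, ∀ x ∈ W, k • x ∈ W := fun k hk x hx => smul_mem_orbitSubmodule hk hx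
  have hWtop : W < ⊤ := by
    refine lt_top_iff_ne_top.2 fun h => ?_
    rw [eq_top_of_orbitSubmodule_eq_top h, Subgroup.index_top] at hK
    rw [← hK, one_mul] at hcard
    have := Nat.pow_lt_pow_right hq (show 1 < Fintype.card ι by omega)
    rw [pow_one] at this
    omega
  have hWlt := Submodule.finrank_lt hWtop.ne
  have hWpos : 0 < Module.finrank F W :=
    Module.finrank_pos_iff_exists_ne_zero.2 ⟨⟨v, hvW⟩, fun h => hv (congrArg Subtype.val h)⟩
  rw [Module.finrank_fintype_fun_eq_card] at hWlt
  by_cases h₁ : Module.finrank F W = 1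
  · refine Or.inl ⟨Projectivization.mk F v hv,
      heq (index_stabilizer_of_transitive _ _) fun k hk => ?_⟩
    rw [Projectivization.mem_stabilizer_mk]
    obtain ⟨c, hc⟩ := (finrank_eq_one_iff_of_nonzero' (⟨v, hvW⟩ : W)
      fun h => hv (congrArg Subtype.val h)).1 h₁ ⟨k • v, hKW k hk v hvW⟩
    exact ⟨c, congrArg Subtype.val hc⟩
  by_cases h₂ : Module.finrank F W + 1 = Fintype.card ι
  · obtain ⟨g, hg, hWg⟩ := Submodule.exists_le_ker_of_lt_top W hWtop
    obtain ⟨w, rfl⟩ := (dotProductEquiv F ι).surjective g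
    have hw : w ≠ 0 := by simpa using hg
    have hker : W = LinearMap.ker (dotProductEquiv F ι w) := by
      refine Submodule.eq_of_le_of_finrank_eq hWg ?_
      have := Module.finrank_add_one_of_forall_mem_iff_dotProduct_eq_zero hw
        (W := LinearMap.ker (dotProductEquiv F ι w)) fun _ => Iff.rfl
      omega
    have hmem (z : ι → F) : z ∈ W ↔ w ⬝ᵥ z = 0 := hker ▸ Iff.rfl
    refine Or.inr ⟨DualPoint.mk w hw, heq (index_stabilizer_of_transitive _ _) fun k hk => ?_⟩
    rw [DualPoint.mem_stabilizer_mk]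
    exact exists_smul_eq_contragredient_smul fun z hz =>
      (hmem _).1 (hKW _ (K.inv_mem hk) z ((hmem z).2 hz))
  · exfalso
    have h₃ := card_pow_le_index hKW
    rw [hK] at h₃
    generalize Module.finrank F W = k at *
    obtain ⟨l, hl⟩ : ∃ l, Fintype.card ι = k + l := ⟨Fintype.card ι - k, by omega⟩
    rw [hl, Nat.add_sub_cancel_left] at h₃
    have h₄ : k + l ≤ k * l := by nlinarith [show 2 ≤ k by omega, show 2 ≤ l by omega]
    have h₅ := (Nat.pow_le_pow_right hq.le h₄).trans h₃
    rw [hl] at hcard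
    have h₆ := Nat.le_mul_of_pos_right (Nat.card (ℙ F (ι → F)))
      (show 0 < Fintype.card F - 1 by omega)
    have h₇ := Nat.pow_pos (n := k + l) (show 0 < Fintype.card F by omega)
    omega

end Matrix.SpecialLinearGroup

end Index

section Projective

theorem comap_stabilizer_of_smul_eq {G S X : Type*} [Group G] [Group S] [MulAction G X]
    [MulAction S X] (π : G →* S) (h : ∀ (g : G) (x : X), π g • x = g • x) (x : X) :
    (stabilizer S x).comap π = stabilizer G x := by
  ext g
  rw [Subgroup.mem_comap, mem_stabilizer_iff, mem_stabilizer_iff, h]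

theorem exists_isCoatom_normalCore_eq_bot_projectiveSpecialLinearGroup {ι F : Type*} [Fintype ι]
    [DecidableEq ι] [Field F] [Fintype F] (hι : 2 < Fintype.card ι)
    (R : Subgroup (MulAut (Matrix.ProjectiveSpecialLinearGroup ι F)))
    (hR : (MulAut.conj : Matrix.ProjectiveSpecialLinearGroup ι F →*
      MulAut (Matrix.ProjectiveSpecialLinearGroup ι F)).range ≤ R) :
    ∃ M : Subgroup R, IsCoatom M ∧ M.normalCore = ⊥ ∧
      (M.index = Nat.card (ℙ F (ι → F)) ∨
        M.index = Nat.card {p : ℙ F (ι → F) × DualPoint ι F // DualPoint.Incident p.1 p.2}) := by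
  have : Nontrivial ι := Fintype.one_lt_card_iff_nontrivial.1 (by omega)
  let π := QuotientGroup.mk' (Subgroup.center (Matrix.SpecialLinearGroup ι F))
  have hπ : Function.Surjective π := QuotientGroup.mk'_surjective _
  have hX := comap_stabilizer_of_smul_eq (X := ℙ F (ι → F)) π
    Matrix.ProjectiveSpecialLinearGroup.smul_proj_mk
  have hY := comap_stabilizer_of_smul_eq (X := DualPoint ι F) π
    DualPoint.projectiveSpecialLinearGroup_smul
  have hXY (x y) : (stabilizer (Matrix.ProjectiveSpecialLinearGroup ι F) (x : ℙ F (ι → F)) ⊓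
      stabilizer _ (y : DualPoint ι F)).comap π = stabilizer _ x ⊓ stabilizer _ y := by
    rw [Subgroup.comap_inf, hX, hY]
  have : IsPretransitive (Matrix.ProjectiveSpecialLinearGroup ι F) (DualPoint ι F) :=
    ⟨fun y y' => by
      obtain ⟨g, hg⟩ := exists_smul_eq (Matrix.SpecialLinearGroup ι F) y y'
      exact ⟨π g, hg⟩⟩
  have : Nontrivial (ℙ F (ι → F)) := by
    rw [← Finite.one_lt_card_iff_nontrivial]
    have h := Projectivization.natCard_mul (F := F) (ι → F)
    rw [Module.finrank_fintype_fun_eq_card] at h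
    have hq := Fintype.one_lt_card (α := F)
    have := Nat.pow_lt_pow_right hq (show 1 < Fintype.card ι by omega)
    rw [pow_one] at this
    by_contra hN
    have := Nat.mul_le_mul_right (Fintype.card F - 1) (not_lt.1 hN)
    omega
  refine exists_isCoatom_normalCore_eq_bot DualPoint.Incident (DualPoint.exists_incident hι)
    ?_ ?_ ?_ ?_ ?_ _ _ rfl DualPoint.natCard ?_ ?_ R hR
  · intro x y x' y' h h'
    obtain ⟨g, hg⟩ := DualPoint.exists_smul_eq_and_smul_eq (iff_of_true h h')
    exact ⟨π g, hg⟩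
  · intro x y x' h hle
    have := Subgroup.comap_mono (f := π) hle
    rw [hXY, hX] at this
    exact DualPoint.eq_of_stabilizer_inf_le_stabilizer h this
  · intro x y x' h hle
    have := Subgroup.comap_mono (f := π) hle
    rw [hXY, hY] at this
    exact DualPoint.eq_of_stabilizer_inf_le_stabilizer' h this
  · intro x y h
    have := congrArg (Subgroup.comap π) h
    rw [hX, hY] at this
    exact DualPoint.stabilizer_ne_stabilizer hι x y this
  · intro x y h K hK hKx hKy
    apply Subgroup.comap_injective hπ
    rw [← Subgroup.comap_le_comap_of_surjective hπ, hX] at hKx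
    rw [← Subgroup.comap_le_comap_of_surjective hπ, hY] at hKy
    rw [← Subgroup.comap_le_comap_of_surjective hπ, hXY] at hK
    rw [DualPoint.eq_top_of_stabilizer_inf_le h _ hK hKx hKy, Subgroup.comap_top]
  · intro K hK
    rw [← Subgroup.index_comap_of_surjective K hπ] at hK
    simp_rw [← (Subgroup.comap_injective hπ).eq_iff, hX, hY]
    exact Matrix.SpecialLinearGroup.eq_stabilizer_of_index_eq hι hK
  · intro x y
    rw [← Subgroup.index_comap_of_surjective _ hπ, hXY]
    exact DualPoint.index_stabilizer_inf_eq_iff hι x y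

end Projective

end

open scoped MatrixGroups

/-- Let `q` be a prime power, `n ≥ 3` with `(n,q) ∉ {(3,2),(4,2)}`, and
let `S = PSL n q` (realized over a field `F` with `q` elements), identified with
`Inn S = (MulAut.conj).range ≤ Aut S`. Then every group `R` with `S ≤ R ≤ Aut S` has a
core-free maximal subgroup of index `(qⁿ - 1)/(q - 1)` or `(qⁿ - 1)(q^{n-1} - 1)/(q - 1)²`
(the equalities being stated in cleared-denominator form). -/
theorem stmt_10 (n q : ℕ) (hq : ∃ p k : ℕ, p.Prime ∧ 0 < k ∧ q = p ^ k)
    (hn : 3 ≤ n) (h32 : ¬(n = 3 ∧ q = 2)) (h42 : ¬(n = 4 ∧ q = 2))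
    (F : Type*) [Field F] [Fintype F] (hF : Fintype.card F = q)
    (R : Subgroup (MulAut (Matrix.ProjectiveSpecialLinearGroup (Fin n) F)))
    (hR : (MulAut.conj : Matrix.ProjectiveSpecialLinearGroup (Fin n) F →*
      MulAut (Matrix.ProjectiveSpecialLinearGroup (Fin n) F)).range ≤ R) :
    ∃ M : Subgroup R, IsCoatom M ∧ M.normalCore = ⊥ ∧
      (M.index * (q - 1) = q ^ n - 1 ∨
        M.index * (q - 1) ^ 2 = (q ^ n - 1) * (q ^ (n - 1) - 1)) := by
  obtain ⟨M, hM, hM', h⟩ := exists_isCoatom_normalCore_eq_bot_projectiveSpecialLinearGroup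
    (by rwa [Fintype.card_fin]) R hR
  refine ⟨M, hM, hM', h.imp (fun h => ?_) fun h => ?_⟩
  · rw [h, ← hF, Projectivization.natCard_mul, Module.finrank_fintype_fun_eq_card,
      Fintype.card_fin]
  · rw [h, ← hF, DualPoint.natCard_incident_prod_mul, Fintype.card_fin]
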